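/- Let a : ℝ → ℝ be positive and three times differentiable, let H = a'/a (the Hubble parameter) and ξ = 3(H' + H²) = 3a''/a. If a differentiable function R : ℝ → ℝ satisfies the equation R' − 2ξ' = −2H(R − 4ξ) on ℝ, then the function t ↦ a(t)²·(R(t) − 12H(t)² − 6H'(t)) is constant on ℝ; equivalently, there is a constant R⋆ such that R = R⋆/a² + 12H² + 6H'. -/

import Mathlib

/-- In a GRW spacetime with scale factor `a`, Hubble parameter `H = a'/a` and
Ricci eigenvalue `ξ = 3(H' + H²)`, a solution `R` of the contracted-Bianchi ODE
`R' − 2ξ' = −2H(R − 4ξ)` is of the form `R = R⋆/a² + 12H² + 6H'` for a constant `R⋆`;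
equivalently, `a²·(R − 12H² − 6H')` is constant. -/
theorem cotton_scalar_curvature_solution
    (a H ξ R : ℝ → ℝ)
    (ha1 : Differentiable ℝ a)
    (ha2 : Differentiable ℝ (deriv a))
    (ha3 : Differentiable ℝ (deriv (deriv a)))
    (hpos : ∀ t, 0 < a t)
    (hH : ∀ t, H t = deriv a t / a t)
    (hxi : ∀ t, ξ t = 3 * (deriv H t + H t ^ 2))
    (hR : Differentiable ℝ R)
    (hode : ∀ t, deriv R t - 2 * deriv ξ t = -2 * H t * (R t - 4 * ξ t)) :
    ∃ Rstar : ℝ,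
      (∀ t, a t ^ 2 * (R t - 12 * H t ^ 2 - 6 * deriv H t) = Rstar) ∧
      (∀ t, R t = Rstar / a t ^ 2 + 12 * H t ^ 2 + 6 * deriv H t) := by
  have hne : ∀ t, a t ≠ 0 := fun t => (hpos t).ne'
  have hHd : ∀ t, HasDerivAt H ((deriv (deriv a) t * a t - deriv a t * deriv a t) / a t ^ 2) t := by
    rw [funext hH]
    exact fun t => (ha2 t).hasDerivAt.fun_div (ha1 t).hasDerivAt (hne t)
  have hH' : Differentiable ℝ (deriv H) := by
    rw [funext fun t => (hHd t).deriv]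
    exact ((ha3.mul ha1).sub (ha2.mul ha2)).div (ha1.pow 2) fun t => pow_ne_zero 2 (hne t)
  have hξ : ∀ t, deriv ξ t = 3 * (deriv (deriv H) t + 2 * H t * deriv H t) := fun t => by
    rw [funext hxi]
    have h := ((hH' t).hasDerivAt.fun_add
      ((hHd t).differentiableAt.hasDerivAt.fun_pow 2)).const_mul 3
    simpa using h.deriv
  have hconst : ∀ t, HasDerivAt
      (fun t => a t ^ 2 * (R t - 12 * H t ^ 2 - 6 * deriv H t)) 0 t := fun t => by
    have h := ((ha1 t).hasDerivAt.fun_pow 2).fun_mul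
      (((hR t).hasDerivAt.fun_sub
        (((hHd t).differentiableAt.hasDerivAt.fun_pow 2).const_mul 12)).fun_sub
        ((hH' t).hasDerivAt.const_mul 6))
    refine h.congr_deriv ?_
    have hode := hode t
    rw [hξ, hxi] at hode
    have ha : deriv a t = H t * a t := by rw [hH, div_mul_cancel₀ _ (hne t)]
    rw [ha]
    push_cast
    linear_combination a t ^ 2 * hode
  have heq : ∀ t, a t ^ 2 * (R t - 12 * H t ^ 2 - 6 * deriv H t) =
      a 0 ^ 2 * (R 0 - 12 * H 0 ^ 2 - 6 * deriv H 0) := fun t =>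
    is_const_of_deriv_eq_zero (fun t => (hconst t).differentiableAt)
      (fun t => (hconst t).deriv) t 0
  refine ⟨_, heq, fun t => ?_⟩
  rw [← heq t, mul_div_cancel_left₀ _ (pow_ne_zero 2 (hne t))]
  ring
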